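/- Fix t > 0. For u > 0 and x, y ∈ ℝ define q_u(x, y) = (2πu)^{−1/2} ( exp(−(x−y)²/(2u)) − exp(−(x+y)²/(2u)) ). Let g : [0, ∞) × [0, t] → ℝ be bounded and continuous, with g(0, τ) = 0 for all τ ∈ [0, t], and uniformly Hölder continuous in the first variable: there exist α ∈ (0, 1] and K ≥ 0 such that |g(x, τ) − g(y, τ)| ≤ K|x − y|^α for all x, y ≥ 0 and τ ∈ [0, t]. Define V(x, s) = ∫ₛᵗ ∫₀^∞ q_{τ−s}(x, y) g(y, τ) dy dτ for x ≥ 0 and 0 ≤ s ≤ t. Then: (i) V(x, t) = 0 for all x ≥ 0; (ii) V(0, s) = 0 for all s ∈ [0, t]; and (iii) for all x > 0 and s ∈ (0, t), the partial derivatives below exist and ∂V/∂s (x, s) = −(1/2) ∂²V/∂x² (x, s) − g(x, s). -/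

import Mathlib

open MeasureTheory Real

/-- The transition density of Brownian motion killed at `0`. -/
noncomputable def killedBMDensity (u x y : ℝ) : ℝ :=
  (Real.sqrt (2 * Real.pi * u))⁻¹ *
    (Real.exp (-(x - y) ^ 2 / (2 * u)) - Real.exp (-(x + y) ^ 2 / (2 * u)))

open Filter Topology Set

/-- Kernel bound hypothesis. -/
def KB (k : ℝ → ℝ → ℝ) (e : ℝ) : Prop :=
  0 ≤ e ∧ (∀ u, 0 < u → ∀ w, ContinuousAt (Function.uncurry k) (u, w)) ∧
  ∀ u, 0 < u → ∀ w, |k u w| * (1 + w ^ 2 / u) ≤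
    64 * ((Real.sqrt (2 * π * u))⁻¹ * Real.exp (-w ^ 2 / (4 * u))) * u ^ (-e)

noncomputable def kz (u w : ℝ) : ℝ := (Real.sqrt (2 * π * u))⁻¹ * Real.exp (-w ^ 2 / (2 * u))
noncomputable def kf (u w : ℝ) : ℝ := -(w / u) * kz u w
noncomputable def ks (u w : ℝ) : ℝ := (w ^ 2 / u ^ 2 - 1 / u) * kz u w

theorem kz_cont (u : ℝ) (hu : 0 < u) (w : ℝ) : ContinuousAt (Function.uncurry kz) (u, w) := by
  unfold Function.uncurry kz
  have h1 : Real.sqrt (2 * π * u) ≠ 0 := by positivity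
  have h2 : (2 * u) ≠ 0 := by positivity
  apply ContinuousAt.mul
  · exact ContinuousAt.inv₀ (by fun_prop) h1
  · apply ContinuousAt.rexp
    exact ContinuousAt.div (by fun_prop) (by fun_prop) h2

theorem pol_bound (v : ℝ) (hv : 0 ≤ v) :
    (1 + v) ^ 2 * Real.exp (-v / 2) ≤ 64 * Real.exp (-v / 4) := by
  have h1 : (1 + v) / 8 ≤ Real.exp (v / 8) := by
    have := Real.add_one_le_exp (v / 8); linarith
  have h2 : ((1 + v) / 8) ^ 2 ≤ Real.exp (v / 8) ^ 2 := by gcongr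
  have h3 : Real.exp (v / 8) ^ 2 * Real.exp (-v / 2) = Real.exp (-v / 4) := by
    rw [← Real.exp_nat_mul, ← Real.exp_add]; congr 1; push_cast; ring
  have := mul_le_mul_of_nonneg_right h2 (Real.exp_pos (-v / 2)).le
  rw [h3] at this
  linarith

theorem kz_nonneg (u w : ℝ) : 0 ≤ kz u w := by unfold kz; positivity

theorem kz_bound (u : ℝ) (hu : 0 < u) (w : ℝ) :
    (1 + w ^ 2 / u) ^ 2 * kz u w ≤
      64 * ((Real.sqrt (2 * π * u))⁻¹ * Real.exp (-w ^ 2 / (4 * u))) := by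
  have h := pol_bound (w ^ 2 / u) (by positivity)
  have e1 : -w ^ 2 / (2 * u) = -(w ^ 2 / u) / 2 := by field_simp
  have e2 : -w ^ 2 / (4 * u) = -(w ^ 2 / u) / 4 := by field_simp
  unfold kz
  rw [e1, e2]
  have := mul_le_mul_of_nonneg_left h (inv_nonneg.2 (Real.sqrt_nonneg (2 * π * u)))
  linarith

theorem KB_z : KB kz 0 := by
  refine ⟨le_rfl, kz_cont, fun u hu w => ?_⟩
  have h := kz_bound u hu w
  have hz := kz_nonneg u w
  rw [abs_of_nonneg hz]
  simp only [neg_zero, Real.rpow_zero, mul_one]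
  refine le_trans ?_ h
  have : 0 ≤ w ^ 2 / u := by positivity
  nlinarith [mul_nonneg hz this, mul_nonneg hz (mul_nonneg this this)]

theorem KB_f : KB kf (1 / 2) := by
  refine ⟨by norm_num, fun u hu w => ?_, fun u hu w => ?_⟩
  · have := kz_cont u hu w
    have h2 : ContinuousAt (fun p : ℝ × ℝ => -(p.2 / p.1)) (u, w) :=
      (ContinuousAt.div (by fun_prop) (by fun_prop) hu.ne').neg
    exact h2.mul this
  · have h := kz_bound u hu w
    have hz := kz_nonneg u w
    have hu2 : u ^ (-(1 / 2) : ℝ) = (Real.sqrt u)⁻¹ := by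
      rw [Real.rpow_neg hu.le, Real.sqrt_eq_rpow]
    rw [hu2]
    have hs : 0 < Real.sqrt u := Real.sqrt_pos.2 hu
    have hss : Real.sqrt u ^ 2 = u := Real.sq_sqrt hu.le
    have h3 : |w / u| ≤ (1 + w ^ 2 / u) * (Real.sqrt u)⁻¹ := by
      rw [← hss] 
      set r := Real.sqrt u with hr
      rw [Real.sqrt_sq hs.le]
      have hw : |w| = |w / r| * r := by rw [abs_div, abs_of_pos hs]; field_simp
      have e1 : |w / r ^ 2| = |w / r| * r⁻¹ := by
        rw [abs_div, abs_div, abs_of_pos hs, abs_of_pos (by positivity : 0 < r ^ 2)]; field_simp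
      rw [e1, ← div_pow, ← sq_abs (w / r)]
      have : 0 ≤ r⁻¹ := by positivity
      gcongr
      nlinarith [sq_nonneg (|w / r| - 1), abs_nonneg (w / r)]
    unfold kf
    rw [abs_mul, abs_neg, abs_of_nonneg hz]
    have h4 : 0 ≤ 1 + w ^ 2 / u := by positivity
    calc |w / u| * kz u w * (1 + w ^ 2 / u)
        ≤ ((1 + w ^ 2 / u) * (Real.sqrt u)⁻¹) * kz u w * (1 + w ^ 2 / u) := by gcongr
      _ = ((1 + w ^ 2 / u) ^ 2 * kz u w) * (Real.sqrt u)⁻¹ := by ring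
      _ ≤ _ := by gcongr

theorem KB_s : KB ks 1 := by
  refine ⟨by norm_num, fun u hu w => ?_, fun u hu w => ?_⟩
  · have := kz_cont u hu w
    have h2 : ContinuousAt (fun p : ℝ × ℝ => p.2 ^ 2 / p.1 ^ 2 - 1 / p.1) (u, w) := by
      apply ContinuousAt.sub
      · exact (ContinuousAt.div (by fun_prop) (by fun_prop) (by positivity))
      · exact (ContinuousAt.div (by fun_prop) (by fun_prop) hu.ne')
    exact h2.mul this
  · have h := kz_bound u hu w
    have hz := kz_nonneg u w
    rw [Real.rpow_neg_one]
    have h3 : |w ^ 2 / u ^ 2 - 1 / u| ≤ (1 + w ^ 2 / u) * u⁻¹ := by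
      have e : w ^ 2 / u ^ 2 - 1 / u = (w ^ 2 / u - 1) * u⁻¹ := by field_simp
      have : 0 ≤ w ^ 2 / u := by positivity
      rw [e, abs_mul, abs_of_pos (inv_pos.2 hu)]
      gcongr
      rw [abs_le]; constructor <;> linarith
    unfold ks
    rw [abs_mul, abs_of_nonneg hz]
    have h4 : 0 ≤ 1 + w ^ 2 / u := by positivity
    calc |w ^ 2 / u ^ 2 - 1 / u| * kz u w * (1 + w ^ 2 / u)
        ≤ ((1 + w ^ 2 / u) * u⁻¹) * kz u w * (1 + w ^ 2 / u) := by gcongr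
      _ = ((1 + w ^ 2 / u) ^ 2 * kz u w) * u⁻¹ := by ring
      _ ≤ _ := by gcongr

theorem kz_deriv (u : ℝ) (hu : 0 < u) (w : ℝ) : HasDerivAt (kz u) (kf u w) w := by
  have h : HasDerivAt (fun w : ℝ => -w ^ 2 / (2 * u)) (-(w / u)) w := by
    have := (((hasDerivAt_id w).pow 2).neg).div_const (2 * u)
    refine this.congr_deriv ?_
    simp; field_simp
  have := (h.exp).const_mul (Real.sqrt (2 * π * u))⁻¹
  refine this.congr_deriv ?_
  unfold kf kz; ring

theorem kf_deriv (u : ℝ) (hu : 0 < u) (w : ℝ) : HasDerivAt (kf u) (ks u w) w := by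
  have h : HasDerivAt (fun w : ℝ => -(w / u)) (-(1 / u)) w :=
    ((hasDerivAt_id w).div_const u).neg
  have := h.mul (kz_deriv u hu w)
  refine this.congr_deriv ?_
  unfold ks kf; field_simp; ring

theorem kz_deriv_u (u : ℝ) (hu : 0 < u) (w : ℝ) :
    HasDerivAt (fun u => kz u w) (1 / 2 * ks u w) u := by
  have hp : 0 < 2 * π * u := by positivity
  have h1 : HasDerivAt (fun u : ℝ => 2 * π * u) (2 * π) u := by
    simpa using (hasDerivAt_id u).const_mul (2 * π)
  have h2 := (h1.sqrt hp.ne').inv (by positivity)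
  have h3 : HasDerivAt (fun u : ℝ => -w ^ 2 / (2 * u)) (w ^ 2 / (2 * u ^ 2)) u := by
    have h4 : HasDerivAt (fun u : ℝ => 2 * u) 2 u := by
      simpa using (hasDerivAt_id u).const_mul 2
    have := (hasDerivAt_const u (-w ^ 2)).div h4 (by positivity)
    refine this.congr_deriv ?_
    field_simp; ring
  have := h2.mul h3.exp
  refine this.congr_deriv ?_
  unfold ks kz
  have hq : Real.sqrt (2 * π * u) ^ 2 = 2 * π * u := Real.sq_sqrt hp.le
  have hq0 : Real.sqrt (2 * π * u) ≠ 0 := by positivity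
  rw [hq]
  simp only [Pi.inv_apply]
  field_simp
  ring

/-! Gaussian integral. -/

theorem gauss_int (b : ℝ) (hb : 0 < b) (x : ℝ) :
    Integrable (fun y : ℝ => Real.exp (-(x - y) ^ 2 / b)) := by
  have := (integrable_exp_neg_mul_sq (inv_pos.2 hb)).comp_sub_left x
  refine this.congr (Eventually.of_forall fun y => ?_)
  simp only
  congr 1; field_simp

theorem gauss_val (b : ℝ) (x : ℝ) :
    ∫ y : ℝ, Real.exp (-(x - y) ^ 2 / b) = Real.sqrt (π * b) := by
  have h := integral_gaussian b⁻¹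
  rw [← integral_sub_left_eq_self _ _ x] at h
  rw [div_inv_eq_mul] at h
  rw [← h]
  congr 1; ext y; congr 1; ring

theorem kz_int (u : ℝ) (hu : 0 < u) (x : ℝ) : ∫ y, kz u (x - y) = 1 := by
  unfold kz
  rw [integral_const_mul, gauss_val]
  have : π * (2 * u) = 2 * π * u := by ring
  rw [this]
  have : Real.sqrt (2 * π * u) ≠ 0 := by positivity
  field_simp

theorem KB.dom {k e} (h : KB k e) {a b x0 : ℝ} (ha : 0 < a) (hb : 0 < b) :
    ∃ D : ℝ, 0 ≤ D ∧ ∀ u x y, a ≤ u → u ≤ b → |x - x0| ≤ 1 →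
      |k u (x - y)| ≤ D * Real.exp (-(x0 - y) ^ 2 / (8 * b)) := by
  refine ⟨64 * ((Real.sqrt (2 * π * a))⁻¹ * Real.exp (1 / (4 * b))) * a ^ (-e), by positivity, ?_⟩
  intro u x y hau hub hx
  have hu : 0 < u := ha.trans_le hau
  have h1 := h.2.2 u hu (x - y)
  have h0 : |k u (x - y)| ≤ |k u (x - y)| * (1 + (x - y) ^ 2 / u) := by
    have : 0 ≤ (x - y) ^ 2 / u := by positivity
    nlinarith [abs_nonneg (k u (x - y))]
  have h2 : Real.exp (-(x - y) ^ 2 / (4 * u)) ≤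
      Real.exp (1 / (4 * b)) * Real.exp (-(x0 - y) ^ 2 / (8 * b)) := by
    rw [← Real.exp_add]
    apply Real.exp_le_exp.2
    have e1 : (x - y) ^ 2 / (4 * b) ≤ (x - y) ^ 2 / (4 * u) := by gcongr
    have e2 : (x0 - y) ^ 2 ≤ 2 * (x - y) ^ 2 + 2 := by
      have : (x - x0) ^ 2 ≤ 1 := by rw [← sq_abs]; nlinarith [abs_nonneg (x - x0)]
      nlinarith [sq_nonneg ((x - y) + (x - x0))]
    have e3 : (x0 - y) ^ 2 / (8 * b) ≤ (2 * (x - y) ^ 2 + 2) / (8 * b) := by gcongr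
    have e4 : (2 * (x - y) ^ 2 + 2) / (8 * b) = (x - y) ^ 2 / (4 * b) + 1 / (4 * b) := by
      field_simp; ring
    rw [neg_div, neg_div]; linarith
  have h3 : (Real.sqrt (2 * π * u))⁻¹ ≤ (Real.sqrt (2 * π * a))⁻¹ := by gcongr
  have h4 : u ^ (-e) ≤ a ^ (-e) :=
    Real.rpow_le_rpow_of_nonpos ha hau (by linarith [h.1])
  calc |k u (x - y)| ≤ _ := h0.trans h1
    _ ≤ 64 * ((Real.sqrt (2 * π * a))⁻¹ *
        (Real.exp (1 / (4 * b)) * Real.exp (-(x0 - y) ^ 2 / (8 * b)))) * a ^ (-e) := by gcongr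
    _ = _ := by ring

theorem KB.cont_w {k e} (h : KB k e) {u : ℝ} (hu : 0 < u) : Continuous (k u) := by
  rw [continuous_iff_continuousAt]
  intro w
  have := h.2.1 u hu w
  exact ContinuousAt.comp (f := fun w => (u, w)) (g := Function.uncurry k) this (by fun_prop)

theorem KB.integrable {k e} (h : KB k e) {u : ℝ} (hu : 0 < u) (x : ℝ) :
    Integrable (fun y => k u (x - y)) := by
  obtain ⟨D, hD, hd⟩ := h.dom (x0 := x) hu hu
  refine ((gauss_int (8 * u) (by positivity) x).const_mul D).mono' ?_ ?_
  · have := h.cont_w hu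
    exact (by fun_prop : Continuous fun y => k u (x - y)).aestronglyMeasurable
  · exact Eventually.of_forall fun y => hd u x y le_rfl le_rfl (by simp)

theorem ks_int (u : ℝ) (hu : 0 < u) (x : ℝ) : ∫ y, ks u (x - y) = 0 := by
  rw [integral_sub_left_eq_self (fun y => ks u y)]
  have i0 : ∀ {k e}, KB k e → Integrable (k u) := fun {k e} h => by
    have := (h.integrable hu 0).comp_sub_left 0
    simpa using this
  exact integral_eq_zero_of_hasDerivAt_of_integrable (kf_deriv u hu) (i0 KB_s) (i0 KB_f)

noncomputable def BB (k G : ℝ → ℝ → ℝ) (u x τ : ℝ) : ℝ := ∫ y, k u (x - y) * G y τ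

theorem G_cont_left {G : ℝ → ℝ → ℝ} (hG : Continuous (Function.uncurry G)) (τ : ℝ) :
    Continuous (fun y => G y τ) :=
  hG.comp (by fun_prop : Continuous fun y : ℝ => (y, τ))

theorem G_cont_right {G : ℝ → ℝ → ℝ} (hG : Continuous (Function.uncurry G)) (y : ℝ) :
    Continuous (fun τ => G y τ) :=
  hG.comp (by fun_prop : Continuous fun τ : ℝ => (y, τ))

theorem BB_meas {k e G} (h : KB k e) (hG : Continuous (Function.uncurry G)) {u : ℝ} (hu : 0 < u)
    (x τ : ℝ) : AEStronglyMeasurable (fun y => k u (x - y) * G y τ) volume := by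
  have h1 := h.cont_w hu
  have h2 := G_cont_left hG τ
  exact (by fun_prop : Continuous fun y => k u (x - y) * G y τ).aestronglyMeasurable

theorem BB_integrable {k e G M} (h : KB k e) (hG : Continuous (Function.uncurry G))
    (hM : ∀ y τ, |G y τ| ≤ M) {u : ℝ} (hu : 0 < u) (x τ : ℝ) :
    Integrable (fun y => k u (x - y) * G y τ) := by
  refine ((h.integrable hu x).norm.mul_const M).mono' (BB_meas h hG hu x τ) ?_
  refine Eventually.of_forall fun y => ?_
  rw [norm_mul]
  exact mul_le_mul_of_nonneg_left (hM y τ) (norm_nonneg _)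

theorem BB_cont {k e G M} (h : KB k e) (hG : Continuous (Function.uncurry G))
    (hM : ∀ y τ, |G y τ| ≤ M) {u : ℝ} (hu : 0 < u) (x τ : ℝ) :
    ContinuousAt (fun p : ℝ × ℝ × ℝ => BB k G p.1 p.2.1 p.2.2) (u, x, τ) := by
  obtain ⟨D, hD, hd⟩ := h.dom (x0 := x) (a := u / 2) (b := 2 * u) (by positivity) (by positivity)
  have n1 : ∀ᶠ p : ℝ × ℝ × ℝ in 𝓝 (u, x, τ), u / 2 < p.1 :=
    (by fun_prop : ContinuousAt (fun p : ℝ × ℝ × ℝ => p.1) (u, x, τ)).eventually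
      (lt_mem_nhds (by simp; linarith))
  have n2 : ∀ᶠ p : ℝ × ℝ × ℝ in 𝓝 (u, x, τ), p.1 < 2 * u :=
    (by fun_prop : ContinuousAt (fun p : ℝ × ℝ × ℝ => p.1) (u, x, τ)).eventually
      (gt_mem_nhds (by simp; linarith))
  have n3 : ∀ᶠ p : ℝ × ℝ × ℝ in 𝓝 (u, x, τ), |p.2.1 - x| < 1 :=
    (by fun_prop : ContinuousAt (fun p : ℝ × ℝ × ℝ => |p.2.1 - x|) (u, x, τ)).eventually
      (gt_mem_nhds (by simp))
  unfold BB
  refine continuousAt_of_dominated (bound := fun y =>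
    D * Real.exp (-(x - y) ^ 2 / (8 * (2 * u))) * M) ?_ ?_ ?_ ?_
  · filter_upwards [n1] with p hp
    exact BB_meas h hG (by linarith) _ _
  · filter_upwards [n1, n2, n3] with p h1 h2 h3
    refine Eventually.of_forall fun y => ?_
    rw [norm_mul]
    have := hd p.1 p.2.1 y h1.le h2.le h3.le
    exact mul_le_mul this (hM _ _) (abs_nonneg _) (by positivity)
  · exact ((gauss_int _ (by positivity) x).const_mul D).mul_const M
  · refine Eventually.of_forall fun y => ?_
    apply ContinuousAt.mul
    · exact ContinuousAt.comp (f := fun p : ℝ × ℝ × ℝ => (p.1, p.2.1 - y))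
        (g := Function.uncurry k) (h.2.1 u hu (x - y)) (by fun_prop)
    · exact ((G_cont_right hG y).comp (by fun_prop :
        Continuous fun p : ℝ × ℝ × ℝ => p.2.2)).continuousAt

theorem BB_deriv_x {k k' e e' G M} (h : KB k e) (h' : KB k' e')
    (hk : ∀ u, 0 < u → ∀ w, HasDerivAt (k u) (k' u w) w)
    (hG : Continuous (Function.uncurry G))
    (hM : ∀ y τ, |G y τ| ≤ M) {u : ℝ} (hu : 0 < u) (x τ : ℝ) :
    HasDerivAt (fun x => BB k G u x τ) (BB k' G u x τ) x := by
  obtain ⟨D, hD, hd⟩ := h'.dom (x0 := x) hu hu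
  refine (hasDerivAt_integral_of_dominated_loc_of_deriv_le (s := Metric.ball x 1)
    (bound := fun y => D * Real.exp (-(x - y) ^ 2 / (8 * u)) * M)
    (F := fun x y => k u (x - y) * G y τ) (F' := fun x y => k' u (x - y) * G y τ)
    (Metric.ball_mem_nhds x one_pos) ?_ ?_ ?_ ?_ ?_ ?_).2
  · exact Eventually.of_forall fun x => BB_meas h hG hu x τ
  · exact BB_integrable h hG hM hu x τ
  · exact BB_meas h' hG hu x τ
  · refine Eventually.of_forall fun y x' hx' => ?_
    rw [norm_mul]
    rw [Metric.mem_ball, Real.dist_eq] at hx'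
    exact mul_le_mul (hd u x' y le_rfl le_rfl hx'.le) (hM _ _) (abs_nonneg _) (by positivity)
  · exact ((gauss_int _ (by positivity) x).const_mul D).mul_const M
  · refine Eventually.of_forall fun y x' hx' => ?_
    exact ((hk u hu (x' - y)).comp_sub_const x' y).mul_const _

theorem BB_deriv_u {k k' e e' G M} (c : ℝ) (h : KB k e) (h' : KB k' e')
    (hk : ∀ u, 0 < u → ∀ w, HasDerivAt (fun u => k u w) (c * k' u w) u)
    (hG : Continuous (Function.uncurry G))
    (hM : ∀ y τ, |G y τ| ≤ M) {u : ℝ} (hu : 0 < u) (x τ : ℝ) :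
    HasDerivAt (fun u => BB k G u x τ) (c * BB k' G u x τ) u := by
  obtain ⟨D, hD, hd⟩ := h'.dom (x0 := x) (a := u / 2) (b := 2 * u) (by positivity) (by positivity)
  unfold BB
  rw [← integral_const_mul]
  refine (hasDerivAt_integral_of_dominated_loc_of_deriv_le (s := Ioo (u / 2) (2 * u))
    (bound := fun y => |c| * (D * Real.exp (-(x - y) ^ 2 / (8 * (2 * u))) * M))
    (F := fun u y => k u (x - y) * G y τ) (F' := fun u y => c * (k' u (x - y) * G y τ))
    (Ioo_mem_nhds (by linarith) (by linarith)) ?_ ?_ ?_ ?_ ?_ ?_).2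
  · filter_upwards [lt_mem_nhds hu] with u hu
    exact BB_meas h hG hu x τ
  · exact BB_integrable h hG hM hu x τ
  · exact (BB_meas h' hG hu x τ).const_mul c
  · refine Eventually.of_forall fun y u' hu' => ?_
    rw [norm_mul, norm_mul]
    refine mul_le_mul_of_nonneg_left ?_ (norm_nonneg _)
    exact mul_le_mul (hd u' x y hu'.1.le hu'.2.le (by simp)) (hM _ _) (abs_nonneg _) (by positivity)
  · exact (((gauss_int _ (by positivity) x).const_mul D).mul_const M).const_mul _
  · refine Eventually.of_forall fun y u' hu' => ?_
    have := (hk u' (by linarith [hu'.1]) (x - y)).mul_const (G y τ)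
    exact this.congr_deriv (by ring)

theorem KB.int_bound {k e} (h : KB k e) {u : ℝ} (hu : 0 < u) (x : ℝ) (c : ℝ) (f : ℝ → ℝ)
    (hc : 0 ≤ c)
    (hf : ∀ y, |f y| ≤ c * (1 + (x - y) ^ 2 / u)) :
    |∫ y, k u (x - y) * f y| ≤ 64 * Real.sqrt 2 * c * u ^ (-e) := by
  have hi := (gauss_int (4 * u) (by positivity) x).const_mul
    (c * 64 * (Real.sqrt (2 * π * u))⁻¹ * u ^ (-e))
  have := norm_integral_le_of_norm_le (f := fun y => k u (x - y) * f y) hi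
    (Eventually.of_forall fun y => ?_)
  · refine this.trans (le_of_eq ?_)
    rw [integral_const_mul, gauss_val]
    have e1 : π * (4 * u) = 2 * (2 * π * u) := by ring
    rw [e1, Real.sqrt_mul (by norm_num : (0:ℝ) ≤ 2) (2 * π * u)]
    have : Real.sqrt (2 * π * u) ≠ 0 := by positivity
    generalize Real.sqrt (2 * π * u) = q at *
    field_simp
  · rw [norm_mul]
    have h1 := h.2.2 u hu (x - y)
    calc |k u (x - y)| * |f y| ≤ |k u (x - y)| * (c * (1 + (x - y) ^ 2 / u)) := by
          gcongr; exact hf y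
      _ = c * (|k u (x - y)| * (1 + (x - y) ^ 2 / u)) := by ring
      _ ≤ c * (64 * ((Real.sqrt (2 * π * u))⁻¹ * Real.exp (-(x - y) ^ 2 / (4 * u))) * u ^ (-e)) := by
          gcongr
      _ = _ := by ring

theorem BB_bound {k e G M} (h : KB k e) (hM : ∀ y τ, |G y τ| ≤ M) {u : ℝ} (hu : 0 < u) (x τ : ℝ) :
    |BB k G u x τ| ≤ 64 * Real.sqrt 2 * M * u ^ (-e) := by
  have hM0 : 0 ≤ M := (abs_nonneg _).trans (hM 0 0)
  refine h.int_bound hu x M _ hM0 fun y => (hM y τ).trans ?_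
  have : 0 ≤ (x - y) ^ 2 / u := by positivity
  nlinarith

theorem rpow_aux {α u w : ℝ} (hα : 0 < α) (hα1 : α ≤ 1) (hu : 0 < u) :
    |w| ^ α ≤ u ^ (α / 2) * (1 + w ^ 2 / u) := by
  have h1 : |w| = u ^ (1 / 2 : ℝ) * (|w| / Real.sqrt u) := by
    rw [← Real.sqrt_eq_rpow]
    have : Real.sqrt u ≠ 0 := by positivity
    field_simp
  have hz : 0 ≤ |w| / Real.sqrt u := by positivity
  have hzz : (|w| / Real.sqrt u) ^ 2 = w ^ 2 / u := by
    rw [div_pow, sq_abs, Real.sq_sqrt hu.le]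
  rw [← hzz]
  generalize |w| / Real.sqrt u = z at *
  rw [h1, Real.mul_rpow (by positivity) hz, ← Real.rpow_mul hu.le]
  have e1 : 1 / 2 * α = α / 2 := by ring
  rw [e1]
  gcongr
  rcases le_total z 1 with h | h
  · have := Real.rpow_le_one hz h hα.le
    nlinarith
  · have := Real.rpow_le_rpow_of_exponent_le h hα1
    rw [Real.rpow_one] at this
    nlinarith

theorem BB_holder {k e G M α K m} (h : KB k e) (hG : Continuous (Function.uncurry G))
    (hM : ∀ y τ, |G y τ| ≤ M) (hα : 0 < α) (hα1 : α ≤ 1) (hK : 0 ≤ K)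
    (hH : ∀ x y τ, |G x τ - G y τ| ≤ K * |x - y| ^ α)
    {u : ℝ} (hu : 0 < u) (x τ : ℝ) (hm : ∫ y, k u (x - y) = m) :
    |BB k G u x τ - m * G x τ| ≤ 64 * Real.sqrt 2 * K * u ^ (α / 2 - e) := by
  have e1 : BB k G u x τ - m * G x τ = ∫ y, k u (x - y) * (G y τ - G x τ) := by
    rw [← hm, ← integral_mul_const]
    unfold BB
    rw [← integral_sub (BB_integrable h hG hM hu x τ) ((h.integrable hu x).mul_const _)]
    congr 1; ext y; ring
  rw [e1]
  refine (h.int_bound hu x (K * u ^ (α / 2)) _ (by positivity) fun y => ?_).trans (le_of_eq ?_)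
  · rw [abs_sub_comm]
    refine (hH x y τ).trans ?_
    rw [mul_assoc]
    gcongr
    exact rpow_aux hα hα1 hu
  · rw [sub_eq_add_neg, Real.rpow_add hu]; ring

/-! The time integral. -/

theorem rpow_intOn {e s t : ℝ} (he : e < 1) :
    IntegrableOn (fun τ : ℝ => (τ - s) ^ (-e)) (Ioc s t) := by
  rcases le_total s t with hst | hst
  · rw [← intervalIntegrable_iff_integrableOn_Ioc_of_le hst]
    have := (intervalIntegral.intervalIntegrable_rpow' (a := 0) (b := t - s)
      (by linarith : -1 < -e)).comp_sub_right s
    simpa using this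
  · simp [Ioc_eq_empty_of_le hst]

theorem BB_meas_τ {k e G M} (h : KB k e) (hG : Continuous (Function.uncurry G))
    (hM : ∀ y τ, |G y τ| ≤ M) (x s t : ℝ) :
    AEStronglyMeasurable (fun τ => BB k G (τ - s) x τ) (volume.restrict (Ioc s t)) := by
  refine ContinuousOn.aestronglyMeasurable ?_ measurableSet_Ioc
  intro τ hτ
  refine ContinuousAt.continuousWithinAt ?_
  exact ContinuousAt.comp (f := fun τ : ℝ => (τ - s, x, τ))
    (g := fun p : ℝ × ℝ × ℝ => BB k G p.1 p.2.1 p.2.2)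
    (BB_cont h hG hM (sub_pos.2 hτ.1) x τ) (by fun_prop)

theorem BB_int_τ {k e G M C} {a : ℝ} (h : KB k e) (hG : Continuous (Function.uncurry G))
    (hM : ∀ y τ, |G y τ| ≤ M) (ha : a < 1)
    (hb : ∀ u, 0 < u → ∀ x τ, |BB k G u x τ| ≤ C * u ^ (-a)) (x s t : ℝ) :
    IntegrableOn (fun τ => BB k G (τ - s) x τ) (Ioc s t) := by
  refine ((rpow_intOn ha).const_mul C).mono' (BB_meas_τ h hG hM x s t) ?_
  refine (ae_restrict_iff' measurableSet_Ioc).2 (Eventually.of_forall fun τ hτ => ?_)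
  exact hb _ (sub_pos.2 hτ.1) x τ

theorem int_deriv_x {k k' e e' G M C C'} {a a' : ℝ} (h : KB k e) (h' : KB k' e')
    (hk : ∀ u, 0 < u → ∀ w, HasDerivAt (k u) (k' u w) w)
    (hG : Continuous (Function.uncurry G))
    (hM : ∀ y τ, |G y τ| ≤ M) (ha : a < 1) (ha' : a' < 1)
    (hb : ∀ u, 0 < u → ∀ x τ, |BB k G u x τ| ≤ C * u ^ (-a))
    (hb' : ∀ u, 0 < u → ∀ x τ, |BB k' G u x τ| ≤ C' * u ^ (-a')) (x s t : ℝ) :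
    HasDerivAt (fun x => ∫ τ in Ioc s t, BB k G (τ - s) x τ)
      (∫ τ in Ioc s t, BB k' G (τ - s) x τ) x := by
  refine (hasDerivAt_integral_of_dominated_loc_of_deriv_le (s := univ)
    (bound := fun τ => C' * (τ - s) ^ (-a'))
    (F := fun x τ => BB k G (τ - s) x τ) (F' := fun x τ => BB k' G (τ - s) x τ)
    univ_mem ?_ ?_ ?_ ?_ ?_ ?_).2
  · exact Eventually.of_forall fun x => BB_meas_τ h hG hM x s t
  · exact BB_int_τ h hG hM ha hb x s t
  · exact BB_meas_τ h' hG hM x s t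
  · refine (ae_restrict_iff' measurableSet_Ioc).2 (Eventually.of_forall fun τ hτ x _ => ?_)
    exact hb' _ (sub_pos.2 hτ.1) x τ
  · exact (rpow_intOn ha').const_mul C'
  · refine (ae_restrict_iff' measurableSet_Ioc).2 (Eventually.of_forall fun τ hτ x _ => ?_)
    exact BB_deriv_x h h' hk hG hM (sub_pos.2 hτ.1) x τ

/-- Continuity in `s` of the singular integral. -/
theorem H_cont {k e G M C} {a : ℝ} (h : KB k e) (hG : Continuous (Function.uncurry G))
    (hM : ∀ y τ, |G y τ| ≤ M) (ha : a < 1)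
    (hb : ∀ u, 0 < u → ∀ x τ, |BB k G u x τ| ≤ C * u ^ (-a)) (x t : ℝ) :
    Continuous (fun r => ∫ τ in Ioc r t, BB k G (τ - r) x τ) := by
  have hC : 0 ≤ C := by
    have := (abs_nonneg _).trans (hb 1 one_pos 0 0); simpa using this
  have e1 : (fun r => ∫ τ in Ioc r t, BB k G (τ - r) x τ) =
      fun r => ∫ u, (Ioc 0 (t - r)).indicator (fun u => BB k G u x (u + r)) u := by
    ext r
    rw [← integral_indicator measurableSet_Ioc, ← integral_add_right_eq_self _ r]
    congr 1; ext u
    by_cases hu : u ∈ Ioc 0 (t - r)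
    · rw [indicator_of_mem hu, indicator_of_mem (by constructor <;> linarith [hu.1, hu.2])]
      simp
    · rw [indicator_of_notMem hu, indicator_of_notMem]
      intro h'; exact hu (by constructor <;> linarith [h'.1, h'.2])
  rw [e1, continuous_iff_continuousAt]
  intro r0
  have hco : ∀ r u, 0 < u → ContinuousAt (fun p : ℝ × ℝ => BB k G p.1 x (p.1 + p.2)) (u, r) := by
    intro r u hu
    exact ContinuousAt.comp (f := fun p : ℝ × ℝ => (p.1, x, p.1 + p.2))
      (g := fun p : ℝ × ℝ × ℝ => BB k G p.1 p.2.1 p.2.2) (BB_cont h hG hM hu x (u + r)) (by fun_prop)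
  refine continuousAt_of_dominated (bound := (Ioc 0 (t - r0 + 1)).indicator
    (fun u => C * u ^ (-a))) ?_ ?_ ?_ ?_
  · refine Eventually.of_forall fun r => ?_
    rw [aestronglyMeasurable_indicator_iff measurableSet_Ioc]
    refine ContinuousOn.aestronglyMeasurable ?_ measurableSet_Ioc
    intro u hu
    refine ContinuousAt.continuousWithinAt ?_
    exact ContinuousAt.comp (f := fun u : ℝ => (u, r))
      (g := fun p : ℝ × ℝ => BB k G p.1 x (p.1 + p.2)) (hco r u hu.1) (by fun_prop)
  · have : ∀ᶠ r in 𝓝 r0, r0 - 1 < r := lt_mem_nhds (by linarith)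
    filter_upwards [this] with r hr
    refine Eventually.of_forall fun u => ?_
    by_cases hu : u ∈ Ioc 0 (t - r)
    · rw [indicator_of_mem hu, indicator_of_mem (by constructor <;> linarith [hu.1, hu.2])]
      exact hb u hu.1 _ _
    · rw [indicator_of_notMem hu]
      simp only [norm_zero]
      refine indicator_nonneg (fun u hu => ?_) u
      have := hu.1
      positivity
  · rw [integrable_indicator_iff measurableSet_Ioc]
    have := (rpow_intOn (s := 0) (t := t - r0 + 1) ha).const_mul C
    simp only [sub_zero] at this
    exact this
  · have : ∀ᵐ u : ℝ, u ≠ t - r0 := by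
      simp [ae_iff, measure_singleton]
    filter_upwards [this] with u hu
    by_cases hu0 : 0 < u
    · rcases lt_or_gt_of_ne hu with h1 | h1
      · have : ContinuousAt (fun r => BB k G u x (u + r)) r0 :=
          ContinuousAt.comp (f := fun r : ℝ => (u, r))
            (g := fun p : ℝ × ℝ => BB k G p.1 x (p.1 + p.2)) (hco r0 u hu0) (by fun_prop)
        refine this.congr ?_
        have : ∀ᶠ r in 𝓝 r0, r < t - u := gt_mem_nhds (by linarith)
        filter_upwards [this] with r hr
        rw [indicator_of_mem (by constructor <;> linarith)]
      · refine (continuousAt_const (y := (0 : ℝ))).congr ?_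
        have : ∀ᶠ r in 𝓝 r0, t - u < r := lt_mem_nhds (by linarith)
        filter_upwards [this] with r hr
        rw [indicator_of_notMem]
        intro h'; linarith [h'.2]
    · refine (continuousAt_const (y := (0 : ℝ))).congr ?_
      refine Eventually.of_forall fun r => ?_
      simp only
      rw [indicator_of_notMem]
      intro h'; exact hu0 h'.1

theorem BBz_formula {G M K C} {α a : ℝ} (hG : Continuous (Function.uncurry G))
    (hM : ∀ y τ, |G y τ| ≤ M) (hα : 0 < α) (hα1 : α ≤ 1) (hK : 0 ≤ K)
    (hH : ∀ x y τ, |G x τ - G y τ| ≤ K * |x - y| ^ α) (ha : a < 1)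
    (hb : ∀ u, 0 < u → ∀ x τ, |BB ks G u x τ| ≤ C * u ^ (-a)) (x s τ : ℝ) (hs : s < τ) :
    BB kz G (τ - s) x τ = G x τ + 1 / 2 * ∫ r in Ioc s τ, BB ks G (τ - r) x τ := by
  have hpos : 0 < τ - s := sub_pos.2 hs
  have hIntv : IntervalIntegrable (fun u => BB ks G u x τ) volume 0 (τ - s) := by
    rw [intervalIntegrable_iff_integrableOn_Ioc_of_le hpos.le]
    have := BB_int_τ (G := fun y _ => G y τ) (M := M) (C := C) KB_s
      ((G_cont_left hG τ).comp continuous_fst) (fun y _ => hM y τ) ha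
      (fun u hu x _ => hb u hu x τ) x 0 (τ - s)
    simp only [sub_zero] at this
    exact this
  have hder : ∀ u, 0 < u → HasDerivAt (fun u => BB kz G u x τ) (1 / 2 * BB ks G u x τ) u :=
    fun u hu => BB_deriv_u (1 / 2) KB_z KB_s kz_deriv_u hG hM hu x τ
  have h0 : Tendsto (fun u => BB kz G u x τ) (𝓝[>] 0) (𝓝 (G x τ)) := by
    rw [tendsto_iff_dist_tendsto_zero]
    have hz : Tendsto (fun u : ℝ => 64 * Real.sqrt 2 * K * u ^ (α / 2 - 0)) (𝓝[>] 0) (𝓝 0) := by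
      have h1 : ContinuousAt (fun u : ℝ => 64 * Real.sqrt 2 * K * u ^ (α / 2 - 0)) 0 :=
        (Real.continuousAt_rpow_const 0 (α / 2 - 0) (Or.inr (by linarith))).const_mul _
      have h2 := h1.tendsto
      rw [Real.zero_rpow (by linarith), mul_zero] at h2
      exact h2.mono_left nhdsWithin_le_nhds
    refine squeeze_zero' (Eventually.of_forall fun _ => dist_nonneg) ?_ hz
    filter_upwards [self_mem_nhdsWithin] with u hu
    have := BB_holder KB_z hG hM hα hα1 hK hH hu x τ (kz_int u hu x)
    rw [Real.dist_eq]
    simpa using this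
  have h1 := intervalIntegral.integral_eq_sub_of_hasDerivAt_of_tendsto hpos
    (fun u hu => hder u hu.1) (hIntv.const_mul (1 / 2)) h0
    ((hder _ hpos).continuousAt.tendsto.mono_left nhdsWithin_le_nhds)
  rw [intervalIntegral.integral_const_mul] at h1
  have h2 := intervalIntegral.integral_comp_sub_left (a := s) (b := τ) (fun u => BB ks G u x τ) τ
  rw [sub_self] at h2
  rw [← intervalIntegral.integral_of_le hs.le, h2, h1]
  ring

theorem Phi_int {G M C} {a : ℝ} (hG : Continuous (Function.uncurry G))
    (hM : ∀ y τ, |G y τ| ≤ M) (ha : a < 1)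
    (hb : ∀ u, 0 < u → ∀ x τ, |BB ks G u x τ| ≤ C * u ^ (-a)) (x s t : ℝ) :
    Integrable (Function.uncurry fun τ r => if r < τ then BB ks G (τ - r) x τ else 0)
      ((volume.restrict (Ioc s t)).prod (volume.restrict (Ioc s t))) := by
  have hC : 0 ≤ C := by
    have := (abs_nonneg _).trans (hb 1 one_pos 0 0); simpa using this
  have hms : MeasurableSet {p : ℝ × ℝ | p.2 < p.1} := measurableSet_lt measurable_snd measurable_fst
  have e1 : (Function.uncurry fun τ r => if r < τ then BB ks G (τ - r) x τ else 0) =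
      {p : ℝ × ℝ | p.2 < p.1}.indicator (fun p => BB ks G (p.1 - p.2) x p.1) := by
    ext p; simp [Function.uncurry, indicator]
  have hf1 : Integrable ((Ioc s t).indicator (fun _ : ℝ => C)) := by
    rw [integrable_indicator_iff measurableSet_Ioc]
    exact integrableOn_const (by simp)
  have hf2 : Integrable ((Ioc 0 (t - s)).indicator (fun u : ℝ => u ^ (-a))) := by
    rw [integrable_indicator_iff measurableSet_Ioc]
    have := rpow_intOn (s := 0) (t := t - s) ha
    simpa using this
  have hf3 := (hf1.convolution_integrand (ContinuousLinearMap.mul ℝ ℝ) hf2)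
  rw [e1, Measure.prod_restrict]
  refine (hf3.mono_measure Measure.restrict_le_self).mono' ?_ ?_
  · refine AEStronglyMeasurable.mono_measure ?_ Measure.restrict_le_self
    rw [aestronglyMeasurable_indicator_iff hms]
    refine ContinuousOn.aestronglyMeasurable ?_ hms
    intro p hp
    refine ContinuousAt.continuousWithinAt ?_
    exact ContinuousAt.comp (f := fun p : ℝ × ℝ => (p.1 - p.2, x, p.1))
      (g := fun p : ℝ × ℝ × ℝ => BB ks G p.1 p.2.1 p.2.2)
      (BB_cont KB_s hG hM (sub_pos.2 hp) x p.1) (by fun_prop)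
  · refine (ae_restrict_iff' (measurableSet_Ioc.prod measurableSet_Ioc)).2
      (Eventually.of_forall fun p hp => ?_)
    obtain ⟨h1, h2⟩ := hp
    simp only [ContinuousLinearMap.mul_apply']
    rw [indicator_of_mem h2]
    by_cases h : p.2 < p.1
    · rw [indicator_of_mem (show p ∈ {p : ℝ × ℝ | p.2 < p.1} from h), indicator_of_mem]
      · exact hb _ (sub_pos.2 h) _ _
      · exact ⟨sub_pos.2 h, by linarith [h1.2, h2.1]⟩
    · rw [indicator_of_notMem (show p ∉ {p : ℝ × ℝ | p.2 < p.1} from h), norm_zero]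
      refine mul_nonneg hC (indicator_nonneg (fun u hu => ?_) _)
      have := hu.1
      positivity

theorem duhamel_s {G M K C} {α a : ℝ} (hG : Continuous (Function.uncurry G))
    (hM : ∀ y τ, |G y τ| ≤ M) (hα : 0 < α) (hα1 : α ≤ 1) (hK : 0 ≤ K)
    (hH : ∀ x y τ, |G x τ - G y τ| ≤ K * |x - y| ^ α) (ha : a < 1)
    (hb : ∀ u, 0 < u → ∀ x τ, |BB ks G u x τ| ≤ C * u ^ (-a)) (x s t : ℝ) :
    ∫ τ in Ioc s t, BB kz G (τ - s) x τ =
      (∫ τ in Ioc s t, G x τ) +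
        1 / 2 * ∫ r in Ioc s t, ∫ τ in Ioc r t, BB ks G (τ - r) x τ := by
  have hP := Phi_int hG hM ha hb x s t
  have hsw := integral_integral_swap hP
  have e1 : ∀ τ ∈ Ioc s t, (∫ r in Ioc s t, if r < τ then BB ks G (τ - r) x τ else 0) =
      ∫ r in Ioc s τ, BB ks G (τ - r) x τ := by
    intro τ hτ
    have : (fun r => if r < τ then BB ks G (τ - r) x τ else 0) =
        (Iio τ).indicator (fun r => BB ks G (τ - r) x τ) := by
      ext r; simp [indicator]
    rw [this, setIntegral_indicator measurableSet_Iio, integral_Ioc_eq_integral_Ioo]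
    congr 2
    ext r; simp only [mem_inter_iff, mem_Ioc, mem_Iio, mem_Ioo]
    constructor
    · rintro ⟨⟨h1, h2⟩, h3⟩; exact ⟨h1, h3⟩
    · rintro ⟨h1, h3⟩; exact ⟨⟨h1, h3.le.trans hτ.2⟩, h3⟩
  have e2 : ∀ r ∈ Ioc s t, (∫ τ in Ioc s t, if r < τ then BB ks G (τ - r) x τ else 0) =
      ∫ τ in Ioc r t, BB ks G (τ - r) x τ := by
    intro r hr
    have : (fun τ => if r < τ then BB ks G (τ - r) x τ else 0) =
        (Ioi r).indicator (fun τ => BB ks G (τ - r) x τ) := by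
      ext τ; simp [indicator]
    rw [this, setIntegral_indicator measurableSet_Ioi]
    congr 2
    ext τ; simp only [mem_inter_iff, mem_Ioc, mem_Ioi]
    constructor
    · rintro ⟨⟨h1, h2⟩, h3⟩; exact ⟨h3, h2⟩
    · rintro ⟨h1, h3⟩; exact ⟨⟨hr.1.trans h1, h3⟩, h1⟩
  rw [setIntegral_congr_fun measurableSet_Ioc e2] at hsw
  rw [← hsw]
  have e3 : ∀ τ ∈ Ioc s t, BB kz G (τ - s) x τ = G x τ +
      1 / 2 * ∫ r in Ioc s t, if r < τ then BB ks G (τ - r) x τ else 0 := by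
    intro τ hτ
    rw [e1 τ hτ]
    exact BBz_formula hG hM hα hα1 hK hH ha hb x s τ hτ.1
  rw [setIntegral_congr_fun measurableSet_Ioc e3, integral_add, integral_const_mul]
  · exact (G_cont_right hG x).integrableOn_Ioc
  · exact hP.integral_prod_left.const_mul _

theorem main_s {G M K C} {α a : ℝ} (hG : Continuous (Function.uncurry G))
    (hM : ∀ y τ, |G y τ| ≤ M) (hα : 0 < α) (hα1 : α ≤ 1) (hK : 0 ≤ K)
    (hH : ∀ x y τ, |G x τ - G y τ| ≤ K * |x - y| ^ α) (ha : a < 1)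
    (hb : ∀ u, 0 < u → ∀ x τ, |BB ks G u x τ| ≤ C * u ^ (-a)) (x s t : ℝ) (hs : s < t) :
    HasDerivAt (fun s => ∫ τ in Ioc s t, BB kz G (τ - s) x τ)
      (-(1 / 2) * (∫ τ in Ioc s t, BB ks G (τ - s) x τ) - G x s) s := by
  have c1 := G_cont_right hG x
  have c2 := H_cont KB_s hG hM ha hb x t
  have d1 := intervalIntegral.integral_hasDerivAt_left (c1.intervalIntegrable s t)
    (c1.stronglyMeasurableAtFilter _ _) c1.continuousAt
  have d2 := intervalIntegral.integral_hasDerivAt_left (c2.intervalIntegrable s t)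
    (c2.stronglyMeasurableAtFilter _ _) c2.continuousAt
  refine ((d1.add (d2.const_mul (1 / 2))).congr_of_eventuallyEq ?_).congr_deriv (by ring)
  filter_upwards [gt_mem_nhds hs] with s hs
  rw [duhamel_s hG hM hα hα1 hK hH ha hb x s t]
  simp only [Pi.add_apply]
  rw [intervalIntegral.integral_of_le hs.le, intervalIntegral.integral_of_le hs.le]

theorem reflect {G M} (hG : Continuous (Function.uncurry G))
    (hM : ∀ y τ, |G y τ| ≤ M) (g : ℝ → ℝ → ℝ) (τ : ℝ)
    (h1 : ∀ y, 0 < y → G y τ = g y τ) (h2 : ∀ y, 0 < y → G (-y) τ = - g y τ)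
    (u : ℝ) (hu : 0 < u) (x : ℝ) :
    ∫ y in Ioi (0:ℝ), killedBMDensity u x y * g y τ = BB kz G u x τ := by
  have hi := BB_integrable KB_z hG hM hu x τ
  unfold BB
  rw [← integral_add_compl (measurableSet_Ioi (a := (0:ℝ))) hi, compl_Ioi]
  have h3 := integral_comp_neg_Ioi 0 (fun y => kz u (x - y) * G y τ)
  rw [neg_zero] at h3
  rw [← h3, ← integral_add hi.integrableOn hi.comp_neg.integrableOn]
  refine setIntegral_congr_fun measurableSet_Ioi fun y hy => ?_
  rw [h1 y hy, h2 y hy]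
  unfold killedBMDensity kz
  rw [sub_neg_eq_add]
  ring

/-- For a bounded continuous source `g` on `[0,∞) × [0,t]`, vanishing at `x = 0` and uniformly
Hölder in the space variable, the Duhamel integral
`V(x,s) = ∫ₛᵗ ∫₀^∞ q_{τ-s}(x,y) g(y,τ) dy dτ` has zero terminal and boundary values and
satisfies `∂V/∂s = -(1/2) ∂²V/∂x² - g` for `x > 0`, `s ∈ (0,t)`. -/
theorem killedBM_duhamel_backward_heat
    (t : ℝ) (ht : 0 < t)
    (g : ℝ → ℝ → ℝ)
    (hg_cont : ContinuousOn (Function.uncurry g) (Set.Ici 0 ×ˢ Set.Icc 0 t))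
    (hg_bdd : ∃ M : ℝ, ∀ x ∈ Set.Ici (0:ℝ), ∀ τ ∈ Set.Icc (0:ℝ) t, |g x τ| ≤ M)
    (hg_zero : ∀ τ ∈ Set.Icc (0:ℝ) t, g 0 τ = 0)
    (α : ℝ) (hα : α ∈ Set.Ioc (0:ℝ) 1) (K : ℝ) (hK : 0 ≤ K)
    (hg_holder : ∀ x ∈ Set.Ici (0:ℝ), ∀ y ∈ Set.Ici (0:ℝ), ∀ τ ∈ Set.Icc (0:ℝ) t,
      |g x τ - g y τ| ≤ K * |x - y| ^ α)
    (V : ℝ → ℝ → ℝ)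
    (hV : ∀ x s, V x s
      = ∫ τ in Set.Ioc s t, ∫ y in Set.Ioi (0:ℝ), killedBMDensity (τ - s) x y * g y τ) :
    (∀ x ∈ Set.Ici (0:ℝ), V x t = 0) ∧
    (∀ s ∈ Set.Icc (0:ℝ) t, V 0 s = 0) ∧
    ∃ Vx Vxx Vs : ℝ → ℝ → ℝ,
      (∀ x : ℝ, 0 < x → ∀ s ∈ Set.Ioo (0:ℝ) t, HasDerivAt (fun x' => V x' s) (Vx x s) x) ∧
      (∀ x : ℝ, 0 < x → ∀ s ∈ Set.Ioo (0:ℝ) t, HasDerivAt (fun x' => Vx x' s) (Vxx x s) x) ∧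
      (∀ x : ℝ, 0 < x → ∀ s ∈ Set.Ioo (0:ℝ) t, HasDerivAt (fun s' => V x s') (Vs x s) s) ∧
      (∀ x : ℝ, 0 < x → ∀ s ∈ Set.Ioo (0:ℝ) t,
        Vs x s = -(1 / 2) * Vxx x s - g x s) := by
  obtain ⟨M, hM⟩ := hg_bdd
  obtain ⟨hα0, hα1⟩ := hα
  have hmx : ∀ z : ℝ, max z 0 ∈ Set.Ici (0:ℝ) := fun z => le_max_right z 0
  set c : ℝ → ℝ := fun τ => max 0 (min τ t) with hc
  have hcm : ∀ τ, c τ ∈ Set.Icc (0:ℝ) t := fun τ =>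
    ⟨le_max_left _ _, max_le ht.le (min_le_right _ _)⟩
  have hcc : Continuous c := by fun_prop
  have hce : ∀ τ ∈ Set.Icc (0:ℝ) t, c τ = τ := fun τ hτ => by
    simp [hc, min_eq_left hτ.2, max_eq_right hτ.1]
  set G : ℝ → ℝ → ℝ := fun y τ => g (max y 0) (c τ) - g (max (-y) 0) (c τ) with hGdef
  have hG : Continuous (Function.uncurry G) := by
    have a1 : Continuous (fun p : ℝ × ℝ => (Function.uncurry g) (max p.1 0, c p.2)) :=
      hg_cont.comp_continuous (by fun_prop) fun p => ⟨hmx _, hcm _⟩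
    have a2 : Continuous (fun p : ℝ × ℝ => (Function.uncurry g) (max (-p.1) 0, c p.2)) :=
      hg_cont.comp_continuous (by fun_prop) fun p => ⟨hmx _, hcm _⟩
    exact a1.sub a2
  have hMG : ∀ y τ, |G y τ| ≤ 2 * M := by
    intro y τ
    have b1 := hM (max y 0) (hmx _) (c τ) (hcm τ)
    have b2 := hM (max (-y) 0) (hmx _) (c τ) (hcm τ)
    have := abs_sub (g (max y 0) (c τ)) (g (max (-y) 0) (c τ))
    simp only [hGdef]
    linarith
  have hHG : ∀ x y τ, |G x τ - G y τ| ≤ (2 * K) * |x - y| ^ α := by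
    intro x y τ
    have b1 := hg_holder (max x 0) (hmx _) (max y 0) (hmx _) (c τ) (hcm τ)
    have b2 := hg_holder (max (-x) 0) (hmx _) (max (-y) 0) (hmx _)
      (c τ) (hcm τ)
    have l1 : |max x 0 - max y 0| ≤ |x - y| := abs_max_sub_max_le_abs x y 0
    have l2 : |max (-x) 0 - max (-y) 0| ≤ |x - y| := by
      refine (abs_max_sub_max_le_abs (-x) (-y) 0).trans (le_of_eq ?_)
      rw [← abs_neg]; congr 1; ring
    have m1 := mul_le_mul_of_nonneg_left (Real.rpow_le_rpow (abs_nonneg _) l1 hα0.le) hK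
    have m2 := mul_le_mul_of_nonneg_left (Real.rpow_le_rpow (abs_nonneg _) l2 hα0.le) hK
    have e : G x τ - G y τ = (g (max x 0) (c τ) - g (max y 0) (c τ)) -
        (g (max (-x) 0) (c τ) - g (max (-y) 0) (c τ)) := by simp only [hGdef]; ring
    rw [e]
    refine (abs_sub _ _).trans ?_
    linarith
  have hGp : ∀ y, 0 < y → ∀ τ ∈ Set.Icc (0:ℝ) t, G y τ = g y τ := by
    intro y hy τ hτ
    simp only [hGdef]
    rw [hce τ hτ, max_eq_left hy.le, max_eq_right (by linarith), hg_zero τ hτ, sub_zero]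
  have hGn : ∀ y, 0 < y → ∀ τ ∈ Set.Icc (0:ℝ) t, G (-y) τ = - g y τ := by
    intro y hy τ hτ
    simp only [hGdef]
    rw [hce τ hτ, neg_neg, max_eq_left hy.le, max_eq_right (by linarith), hg_zero τ hτ, zero_sub]
  have hVB : ∀ x, ∀ s, 0 < s → V x s = ∫ τ in Set.Ioc s t, BB kz G (τ - s) x τ := by
    intro x s hs
    rw [hV]
    refine setIntegral_congr_fun measurableSet_Ioc fun τ hτ => ?_
    have hτ' : τ ∈ Set.Icc (0:ℝ) t := ⟨hs.le.trans hτ.1.le, hτ.2⟩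
    exact reflect hG hMG g τ (fun y hy => hGp y hy τ hτ') (fun y hy => hGn y hy τ hτ')
      (τ - s) (sub_pos.2 hτ.1) x
  have bz : ∀ u, 0 < u → ∀ x τ, |BB kz G u x τ| ≤ 64 * Real.sqrt 2 * (2 * M) * u ^ (-(0:ℝ)) :=
    fun u hu x τ => BB_bound KB_z hMG hu x τ
  have bf : ∀ u, 0 < u → ∀ x τ,
      |BB kf G u x τ| ≤ 64 * Real.sqrt 2 * (2 * M) * u ^ (-(1 / 2 : ℝ)) :=
    fun u hu x τ => BB_bound KB_f hMG hu x τ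
  have bs : ∀ u, 0 < u → ∀ x τ,
      |BB ks G u x τ| ≤ 64 * Real.sqrt 2 * (2 * K) * u ^ (-(1 - α / 2)) := by
    intro u hu x τ
    have := BB_holder KB_s hG hMG hα0 hα1 (by positivity : 0 ≤ 2 * K) hHG hu x τ (ks_int u hu x)
    rw [zero_mul, sub_zero] at this
    rwa [neg_sub]
  have ha2 : 1 - α / 2 < 1 := by linarith
  refine ⟨fun x _ => by rw [hV]; simp, fun s _ => ?_,
    fun x s => ∫ τ in Set.Ioc s t, BB kf G (τ - s) x τ,
    fun x s => ∫ τ in Set.Ioc s t, BB ks G (τ - s) x τ,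
    fun x s => -(1 / 2) * (∫ τ in Set.Ioc s t, BB ks G (τ - s) x τ) - g x s, ?_, ?_, ?_, ?_⟩
  · rw [hV]
    simp [killedBMDensity]
  · intro x _ s hs
    have : (fun x' => V x' s) = fun x => ∫ τ in Set.Ioc s t, BB kz G (τ - s) x τ :=
      funext fun x => hVB x s hs.1
    rw [this]
    exact int_deriv_x KB_z KB_f kz_deriv hG hMG (by norm_num) (by norm_num) bz bf x s t
  · intro x _ s hs
    exact int_deriv_x KB_f KB_s kf_deriv hG hMG (by norm_num) ha2 bf bs x s t
  · intro x hx s hs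
    have := main_s hG hMG hα0 hα1 (by positivity : 0 ≤ 2 * K) hHG ha2 bs x s t hs.2
    rw [hGp x hx s ⟨hs.1.le, hs.2.le⟩] at this
    refine this.congr_of_eventuallyEq ?_
    filter_upwards [lt_mem_nhds hs.1] with s hs
    exact hVB x s hs
  · intro x _ s _
    rfl
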